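/- arXiv:1911.10533 — 2 statements merged into one kernel-verified Lean document; each statement's English description precedes it below -/
import Mathlib

section
/- Let P_{n,1} be the n-th monic polynomial orthogonal on [0,1] to x^j, j = 0,...,n-1, with respect to the weight x^{-3/4}(1-x)^{-1/4}. Let Δ = [-1,1] ∪ [-i,i] with segments oriented toward the origin, and let ρ(s) = -i^{4-j}/|sqrt(w(s))| on Δ_j, where sqrt(w) is the branch of ((z^2-1)(z^2+1))^{1/4} squared described in the setup (i.e. the branch of sqrt(w(z)) holomorphic off Δ with sqrt(w)(z) = z + O(1) at ∞). Then ∫_Δ s^k P_{n,1}(s^4) ρ(s) ds = 0 for all k ∈ {0, 1, ..., 4n - 1}, hence Q_{4n}(z) = P_{n,1}(z^4). -/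
open Complex Polynomial intervalIntegral

/-- The orthogonality integral `∫_Δ f(s) ρ(s) ds` over the cross `Δ = [-1,1] ∪ [-i,i]`
(arms oriented towards the origin) for the Jacobi-1/4 weight `ρ(s) = -i^{4-j}/|√w(s)|` on
`Δ_j`, where `|√w(s)| = (1-x⁴)^{1/4}` on the real arms and `(1-y⁴)^{1/4}` on the imaginary
arms; explicitly `ρ = i/(1-x⁴)^{1/4}` on `Δ_1`, `1/(1-y⁴)^{1/4}` on `Δ_2`,
`-i/(1-x⁴)^{1/4}` on `Δ_3` and `-1/(1-y⁴)^{1/4}` on `Δ_4`. -/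
noncomputable def crossIntJac (f : ℂ → ℂ) : ℂ :=
    -(∫ x in (0:ℝ)..1, f (x : ℂ) * (I / (((1 - x ^ 4) ^ ((1:ℝ)/4) : ℝ) : ℂ)))
    + (∫ x in (-1:ℝ)..0, f (x : ℂ) * (-I / (((1 - x ^ 4) ^ ((1:ℝ)/4) : ℝ) : ℂ)))
    + (-I * ∫ y in (0:ℝ)..1, f (I * (y : ℂ)) * (1 / (((1 - y ^ 4) ^ ((1:ℝ)/4) : ℝ) : ℂ)))
    + (I * ∫ y in (-1:ℝ)..0, f (I * (y : ℂ)) * (-1 / (((1 - y ^ 4) ^ ((1:ℝ)/4) : ℝ) : ℂ)))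

/-- `Q` satisfies the orthogonality relations `∫_Δ s^k Q(s) ρ(s) ds = 0`, `k < m`. -/
def OrthoJac (m : ℕ) (Q : ℂ[X]) : Prop :=
  ∀ k < m, crossIntJac (fun s => s ^ k * Q.eval s) = 0


noncomputable def jW (x : ℝ) : ℝ := ((1 - x ^ 4) ^ ((1:ℝ)/4))⁻¹

lemma jW_pos {x : ℝ} (h0 : 0 < x) (h1 : x < 1) : 0 < jW x := by
  unfold jW
  have : 0 < 1 - x ^ 4 := by
    have := pow_lt_one₀ h0.le h1 (n := 4) (by norm_num)
    linarith
  positivity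

lemma jW_int : IntervalIntegrable jW MeasureTheory.volume 0 1 := by
  have h1 : IntervalIntegrable (fun x : ℝ => x ^ (-(1:ℝ)/4)) MeasureTheory.volume 0 1 :=
    intervalIntegrable_rpow' (by norm_num)
  have h2 : IntervalIntegrable (fun x : ℝ => (1 - x) ^ (-(1:ℝ)/4)) MeasureTheory.volume 0 1 := by
    have := (h1.comp_sub_left 1)
    simpa using this.symm
  refine h2.mono_fun ?_ ?_
  · apply Measurable.aestronglyMeasurable
    unfold jW
    fun_prop
  · rw [Set.uIoc_of_le zero_le_one]
    filter_upwards [MeasureTheory.ae_restrict_mem measurableSet_Ioc] with x hx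
    have hx4 : x ^ 4 ≤ x := by
      have := pow_le_pow_of_le_one hx.1.le hx.2 (show 1 ≤ 4 by norm_num)
      simpa using this
    have ha : 0 ≤ 1 - x := by linarith [hx.2]
    have hb : 0 ≤ 1 - x ^ 4 := by linarith
    rw [Real.norm_of_nonneg (Real.rpow_nonneg ha _), Real.norm_of_nonneg (by unfold jW; positivity)]
    unfold jW
    rcases eq_or_lt_of_le hx.2 with h | h
    · subst h
      norm_num
    · rw [neg_div, Real.rpow_neg ha]
      have : 0 < 1 - x := by linarith
      gcongr

lemma jW_int_mul {g : ℝ → ℂ} (hg : Continuous g) :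
    IntervalIntegrable (fun x => g x * (jW x : ℂ)) MeasureTheory.volume 0 1 := by
  have : IntervalIntegrable (fun x => (jW x : ℂ)) MeasureTheory.volume 0 1 := by
    have := jW_int
    rw [intervalIntegrable_iff] at *
    exact this.ofReal
  exact this.continuousOn_mul hg.continuousOn

lemma cross_eq (f : ℂ → ℂ) (hf : Continuous f) : crossIntJac f =
    -I * ∫ x in (0:ℝ)..1, (f x + f (-x) + f (I * x) + f (-(I * x))) * (jW x : ℂ) := by
  have e1 : (∫ x in (-1:ℝ)..0, f (x : ℂ) * (-I / (((1 - x ^ 4) ^ ((1:ℝ)/4) : ℝ) : ℂ)))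
      = -I * ∫ x in (0:ℝ)..1, f (-x) * (jW x : ℂ) := by
    rw [← intervalIntegral.integral_const_mul]
    have := intervalIntegral.integral_comp_neg (a := 0) (b := 1)
      (fun x : ℝ => f (x : ℂ) * (-I / (((1 - x ^ 4) ^ ((1:ℝ)/4) : ℝ) : ℂ)))
    rw [neg_zero] at this
    rw [← this]
    congr 1; ext x
    simp only [jW, ofReal_neg, ofReal_inv, div_eq_mul_inv]
    rw [show (-x)^4 = x^4 by ring]
    ring
  have e2 : (∫ y in (-1:ℝ)..0, f (I * (y : ℂ)) * (-1 / (((1 - y ^ 4) ^ ((1:ℝ)/4) : ℝ) : ℂ)))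
      = -1 * ∫ x in (0:ℝ)..1, f (-(I * x)) * (jW x : ℂ) := by
    rw [← intervalIntegral.integral_const_mul]
    have := intervalIntegral.integral_comp_neg (a := 0) (b := 1)
      (fun y : ℝ => f (I * (y : ℂ)) * (-1 / (((1 - y ^ 4) ^ ((1:ℝ)/4) : ℝ) : ℂ)))
    rw [neg_zero] at this
    rw [← this]
    congr 1; ext x
    simp only [jW, ofReal_neg, ofReal_inv, div_eq_mul_inv, mul_neg]
    rw [show (-x)^4 = x^4 by ring]
    ring
  have e3 : (∫ x in (0:ℝ)..1, f (x : ℂ) * (I / (((1 - x ^ 4) ^ ((1:ℝ)/4) : ℝ) : ℂ)))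
      = I * ∫ x in (0:ℝ)..1, f x * (jW x : ℂ) := by
    rw [← intervalIntegral.integral_const_mul]
    congr 1; ext x
    simp only [jW, ofReal_inv, div_eq_mul_inv]
    ring
  have e4 : (∫ y in (0:ℝ)..1, f (I * (y : ℂ)) * (1 / (((1 - y ^ 4) ^ ((1:ℝ)/4) : ℝ) : ℂ)))
      = ∫ x in (0:ℝ)..1, f (I * x) * (jW x : ℂ) := by
    congr 1; ext x
    simp only [jW, ofReal_inv, div_eq_mul_inv, one_mul]
  unfold crossIntJac
  rw [e1, e2, e3, e4]
  simp only [add_mul]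
  have i1 := jW_int_mul (g := fun x : ℝ => f x) (by fun_prop)
  have i2 := jW_int_mul (g := fun x : ℝ => f (-x)) (by fun_prop)
  have i3 := jW_int_mul (g := fun x : ℝ => f (I * x)) (by fun_prop)
  have i4 := jW_int_mul (g := fun x : ℝ => f (-(I * x))) (by fun_prop)
  rw [intervalIntegral.integral_add ((i1.add i2).add i3) i4,
    intervalIntegral.integral_add (i1.add i2) i3, intervalIntegral.integral_add i1 i2]
  ring

lemma cross_sub (f g : ℂ → ℂ) (hf : Continuous f) (hg : Continuous g) :
    crossIntJac (fun s => f s - g s) = crossIntJac f - crossIntJac g := by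
  rw [cross_eq _ hf, cross_eq _ hg, cross_eq (fun s => f s - g s) (hf.sub hg), ← mul_sub,
    ← intervalIntegral.integral_sub]
  · congr 2; ext x; ring
  · exact jW_int_mul (g := fun x : ℝ => f x + f (-x) + f (I * x) + f (-(I * x))) (by fun_prop)
  · exact jW_int_mul (g := fun x : ℝ => g x + g (-x) + g (I * x) + g (-(I * x))) (by fun_prop)

lemma subst_eq (g : ℝ → ℂ) : (∫ y in (0:ℝ)..1, 4 * g (y ^ 4) * (jW y : ℂ)) =
    ∫ x in (0:ℝ)..1, g x * (((x ^ (-(3:ℝ)/4) * (1 - x) ^ (-(1:ℝ)/4) : ℝ)) : ℂ) := by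
  have himg : (fun y : ℝ => y ^ 4) '' Set.Ioo 0 1 = Set.Ioo 0 1 := by
    ext x
    constructor
    · rintro ⟨y, hy, rfl⟩
      exact ⟨pow_pos hy.1 4, pow_lt_one₀ hy.1.le hy.2 (by norm_num)⟩
    · intro hx
      refine ⟨x ^ ((1:ℝ)/4), ⟨Real.rpow_pos_of_pos hx.1 _,
        Real.rpow_lt_one hx.1.le hx.2 (by norm_num)⟩, ?_⟩
      simp only
      rw [← Real.rpow_natCast, ← Real.rpow_mul hx.1.le]
      norm_num
  rw [intervalIntegral.integral_of_le zero_le_one, intervalIntegral.integral_of_le zero_le_one,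
    MeasureTheory.integral_Ioc_eq_integral_Ioo, MeasureTheory.integral_Ioc_eq_integral_Ioo]
  conv_rhs => rw [← himg]
  rw [MeasureTheory.integral_image_eq_integral_abs_deriv_smul (f' := fun y => 4 * y ^ 3)
    measurableSet_Ioo]
  · apply MeasureTheory.setIntegral_congr_fun measurableSet_Ioo
    intro y hy
    have hy0 := hy.1
    have h4 : 0 < 1 - y ^ 4 := by
      have := pow_lt_one₀ hy.1.le hy.2 (n := 4) (by norm_num)
      linarith
    have h3 : (y ^ 4) ^ (-(3:ℝ)/4) = (y ^ 3)⁻¹ := by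
      rw [← Real.rpow_natCast y 4, ← Real.rpow_mul hy0.le, ← Real.rpow_natCast y 3,
        ← Real.rpow_neg hy0.le]
      norm_num
    simp only [jW, Complex.real_smul]
    rw [abs_of_pos (by positivity), h3, neg_div 4 (1:ℝ), Real.rpow_neg h4.le]
    have : (y : ℂ) ≠ 0 := by exact_mod_cast hy0.ne'
    push_cast
    field_simp
  · intro y _
    simpa using (hasDerivAt_pow 4 y).hasDerivWithinAt
  · intro a ha b hb h
    exact (pow_left_inj₀ ha.1.le hb.1.le (by norm_num)).1 h

lemma pos_zero (m : ℕ) (q : ℂ[X])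
    (h : (∫ y in (0:ℝ)..1, (starRingEnd ℂ (q.eval ((y:ℂ)^4)) * (y:ℂ)^m * q.eval ((y:ℂ)^4))
      * (jW y : ℂ)) = 0) : q = 0 := by
  by_contra hq
  have e : ∀ y : ℝ, (starRingEnd ℂ (q.eval ((y:ℂ)^4)) * (y:ℂ)^m * q.eval ((y:ℂ)^4)) * (jW y : ℂ)
      = ((normSq (q.eval ((y:ℂ)^4)) * y ^ m * jW y : ℝ) : ℂ) := by
    intro y
    push_cast
    rw [normSq_eq_conj_mul_self]
    ring
  have hi := jW_int_mul (g := fun y : ℝ =>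
    (starRingEnd ℂ (q.eval ((y:ℂ)^4)) * (y:ℂ)^m * q.eval ((y:ℂ)^4)))
    (by
      have : Continuous (fun y : ℝ => q.eval ((y:ℂ)^4)) := q.continuous.comp (by fun_prop)
      exact ((continuous_conj.comp this).mul (by fun_prop)).mul this)
  simp only [e] at h hi
  rw [intervalIntegral.integral_ofReal, ofReal_eq_zero] at h
  rw [intervalIntegrable_iff] at hi
  have hi' := hi.re
  simp only [RCLike.re_to_complex, ofReal_re] at hi'
  rw [Set.uIoc_of_le zero_le_one] at hi'
  rw [intervalIntegral.integral_of_le zero_le_one] at h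
  have hi'' : MeasureTheory.IntegrableOn (fun y : ℝ => normSq (q.eval ((y:ℂ)^4)) * y ^ m * jW y)
    (Set.Ioo 0 1) :=
    MeasureTheory.IntegrableOn.mono_set (t := Set.Ioc 0 1) hi' Set.Ioo_subset_Ioc_self
  rw [MeasureTheory.integral_Ioc_eq_integral_Ioo,
    MeasureTheory.setIntegral_eq_zero_iff_of_nonneg_ae _ hi''] at h
  · have hfin : {y : ℝ | (expand ℂ 4 q).eval (y:ℂ) = 0}.Finite := by
      have h0 : expand ℂ 4 q ≠ 0 := (expand_ne_zero (by norm_num)).2 hq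
      have := (expand ℂ 4 q).roots.toFinset.finite_toSet.preimage
        (ofReal_injective.injOn (s := (fun y : ℝ => (y:ℂ)) ⁻¹' _))
      refine this.subset ?_
      intro y hy
      simpa [h0] using hy
    have hae := (MeasureTheory.ae_restrict_of_ae (s := Set.Ioo (0:ℝ) 1)
      (MeasureTheory.compl_mem_ae_iff.2 (hfin.measure_zero MeasureTheory.volume)))
    have hF : ∀ᵐ y ∂(MeasureTheory.volume.restrict (Set.Ioo (0:ℝ) 1)), False := by
      filter_upwards [h, hae, MeasureTheory.ae_restrict_mem measurableSet_Ioo] with y h1 h2 h3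
      have hw := jW_pos h3.1 h3.2
      have hp : 0 < y ^ m := pow_pos h3.1 m
      simp only [Pi.zero_apply, mul_eq_zero, hw.ne', hp.ne', or_false, normSq_eq_zero] at h1
      apply h2
      simpa [expand_eval] using h1
    rw [Filter.eventually_false_iff_eq_bot, MeasureTheory.ae_eq_bot,
      MeasureTheory.Measure.restrict_eq_zero] at hF
    simp at hF
  · filter_upwards [MeasureTheory.ae_restrict_mem measurableSet_Ioo] with y h3
    have hw := jW_pos h3.1 h3.2
    have hp : 0 < y ^ m := pow_pos h3.1 m
    have := normSq_nonneg (q.eval ((y:ℂ)^4))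
    simp only [Pi.zero_apply]
    positivity

lemma orth_zero (n m : ℕ) (q : ℂ[X]) (hq : q.degree < n)
    (h : ∀ j < n, (∫ y in (0:ℝ)..1, ((y:ℂ)^(4*j+m) * q.eval ((y:ℂ)^4)) * (jW y : ℂ)) = 0) :
    q = 0 := by
  apply pos_zero m
  have hc : Continuous (fun y : ℝ => q.eval ((y:ℂ)^4)) := q.continuous.comp (by fun_prop)
  have e : ∀ y : ℝ, (starRingEnd ℂ (q.eval ((y:ℂ)^4)) * (y:ℂ)^m * q.eval ((y:ℂ)^4)) * (jW y : ℂ)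
      = ∑ j ∈ Finset.range n, starRingEnd ℂ (q.coeff j) *
        (((y:ℂ)^(4*j+m) * q.eval ((y:ℂ)^4)) * (jW y : ℂ)) := by
    intro y
    have : starRingEnd ℂ (q.eval ((y:ℂ)^4)) =
        ∑ j ∈ Finset.range n, starRingEnd ℂ (q.coeff j) * (y:ℂ)^(4*j) := by
      rcases eq_or_ne q 0 with rfl | h0
      · simp
      rw [eval_eq_sum_range' ((natDegree_lt_iff_degree_lt h0).2 hq)]
      simp [map_sum, pow_mul]
    rw [this, Finset.sum_mul, Finset.sum_mul, Finset.sum_mul]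
    refine Finset.sum_congr rfl fun j _ => ?_
    ring
  simp only [e]
  rw [intervalIntegral.integral_finsetSum]
  · apply Finset.sum_eq_zero
    intro j hj
    rw [intervalIntegral.integral_const_mul, h j (Finset.mem_range.1 hj), mul_zero]
  · intro j _
    exact (jW_int_mul (g := fun y : ℝ => (y:ℂ)^(4*j+m) * q.eval ((y:ℂ)^4))
      (by fun_prop)).const_mul _

lemma decomp (n : ℕ) : ∀ D : ℂ[X], D.degree < (4 * n : ℕ) → ∃ a b c d : ℂ[X],
    a.degree < n ∧ b.degree < n ∧ c.degree < n ∧ d.degree < n ∧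
    D = expand ℂ 4 a + X * expand ℂ 4 b + X^2 * expand ℂ 4 c + X^3 * expand ℂ 4 d := by
  induction n with
  | zero =>
    intro D hD
    refine ⟨0, 0, 0, 0, by simp, by simp, by simp, by simp, ?_⟩
    have : D = 0 := by
      rw [← degree_eq_bot]
      simpa using hD
    simp [this]
  | succ n ih =>
    intro D hD
    have hD' : D.divX.divX.divX.divX.degree < (4 * n : ℕ) := by
      rw [degree_lt_iff_coeff_zero] at hD ⊢
      intro m hm
      simp only [coeff_divX]
      exact hD _ (by omega)
    obtain ⟨a, b, c, d, ha, hb, hc, hd, he⟩ := ih _ hD'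
    have key : ∀ (p : ℂ[X]) (z : ℂ), p.degree < n → (X * p + C z).degree < (((n+1 : ℕ)) : WithBot ℕ) := by
      intro p z hp
      rw [degree_lt_iff_coeff_zero] at hp ⊢
      intro m hm
      obtain ⟨m, rfl⟩ : ∃ k, m = k + 1 := ⟨m - 1, by omega⟩
      simp [coeff_X_mul, coeff_C, hp m (by omega)]
    refine ⟨X * a + C (D.coeff 0), X * b + C (D.divX.coeff 0), X * c + C (D.divX.divX.coeff 0),
      X * d + C (D.divX.divX.divX.coeff 0), key _ _ ha, key _ _ hb, key _ _ hc, key _ _ hd, ?_⟩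
    have h1 := divX_mul_X_add D
    have h2 := divX_mul_X_add D.divX
    have h3 := divX_mul_X_add D.divX.divX
    have h4 := divX_mul_X_add D.divX.divX.divX
    simp only [map_add, map_mul, expand_X, expand_C]
    linear_combination -h1 - X * h2 - X^2 * h3 - X^3 * h4 + X^4 * he

lemma cross_poly (a b c d : ℂ[X]) (k : ℕ) :
    crossIntJac (fun s => s ^ k * (expand ℂ 4 a + X * expand ℂ 4 b + X^2 * expand ℂ 4 c
      + X^3 * expand ℂ 4 d).eval s) = -I * ∫ y in (0:ℝ)..1,
      ((1 + (-1)^k + I^k + (-I)^k) * (y:ℂ)^k * a.eval ((y:ℂ)^4)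
      + (1 + (-1)^(k+1) + I^(k+1) + (-I)^(k+1)) * (y:ℂ)^(k+1) * b.eval ((y:ℂ)^4)
      + (1 + (-1)^(k+2) + I^(k+2) + (-I)^(k+2)) * (y:ℂ)^(k+2) * c.eval ((y:ℂ)^4)
      + (1 + (-1)^(k+3) + I^(k+3) + (-I)^(k+3)) * (y:ℂ)^(k+3) * d.eval ((y:ℂ)^4))
      * (jW y : ℂ) := by
  rw [cross_eq _ (by fun_prop)]
  congr 2
  ext y
  congr 1
  have h1 : (-(y:ℂ))^4 = (y:ℂ)^4 := by ring
  have h2 : (I * (y:ℂ))^4 = (y:ℂ)^4 := by rw [mul_pow, I_pow_four, one_mul]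
  have h3 : (-(I * (y:ℂ)))^4 = (y:ℂ)^4 := by rw [← h2]; ring
  simp only [eval_add, eval_mul, eval_pow, eval_X, expand_eval, h1, h2, h3]
  rw [neg_pow (y:ℂ) k, mul_pow I, show (-(I * (y:ℂ))) = (-I) * y by ring, mul_pow (-I)]
  ring

lemma pw (j s : ℕ) : (1 + (-1)^(4*j+s) + I^(4*j+s) + (-I)^(4*j+s) : ℂ)
    = 1 + (-1)^s + I^s + (-I)^s := by
  have h : (-I)^4 = 1 := by rw [neg_pow, I_pow_four]; norm_num
  simp only [pow_add, pow_mul, I_pow_four, h, one_pow]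
  norm_num

lemma s0 : (1 + (-1)^0 + I^0 + (-I)^0 : ℂ) = 4 := by norm_num
lemma s1 : (1 + (-1)^1 + I^1 + (-I)^1 : ℂ) = 0 := by ring
lemma s2 : (1 + (-1)^2 + I^2 + (-I)^2 : ℂ) = 0 := by ring_nf; simp
lemma s3 : (1 + (-1)^3 + I^3 + (-I)^3 : ℂ) = 0 := by ring
lemma s4 : (1 + (-1)^4 + I^4 + (-I)^4 : ℂ) = 4 := by
  have := pw 1 0
  simpa [s0] using this.trans s0
lemma s5 : (1 + (-1)^5 + I^5 + (-I)^5 : ℂ) = 0 := (pw 1 1).trans s1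
lemma s6 : (1 + (-1)^6 + I^6 + (-I)^6 : ℂ) = 0 := (pw 1 2).trans s2

lemma ortho_zero (n : ℕ) (D : ℂ[X]) (hD : D.degree < (4 * n : ℕ)) (h : OrthoJac (4 * n) D) :
    D = 0 := by
  obtain ⟨a, b, c, d, ha, hb, hc, hd, rfl⟩ := decomp n D hD
  have fin : ∀ (m : ℕ) (q : ℂ[X]) (j : ℕ),
      (-I * ∫ y in (0:ℝ)..1, (4 * (y:ℂ)^(4*j+m) * q.eval ((y:ℂ)^4)) * (jW y : ℂ)) = 0 →
      (∫ y in (0:ℝ)..1, ((y:ℂ)^(4*j+m) * q.eval ((y:ℂ)^4)) * (jW y : ℂ)) = 0 := by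
    intro m q j h
    simp only [mul_assoc, intervalIntegral.integral_const_mul] at h ⊢
    simpa using h
  have a0 : a = 0 := by
    refine orth_zero n 0 a ha fun j hj => fin _ _ _ ?_
    have := h (4*j+0) (by omega)
    rw [cross_poly] at this
    simp only [add_assoc (4*j), pw] at this
    simpa only [Nat.reduceAdd, s0, s1, s2, s3, zero_mul, add_zero, zero_add] using this
  have b0 : b = 0 := by
    refine orth_zero n 4 b hb fun j hj => fin _ _ _ ?_
    have := h (4*j+3) (by omega)
    rw [cross_poly] at this
    simp only [add_assoc (4*j), pw] at this
    simpa only [Nat.reduceAdd, s3, s4, s5, s6, zero_mul, add_zero, zero_add] using this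
  have c0 : c = 0 := by
    refine orth_zero n 4 c hc fun j hj => fin _ _ _ ?_
    have := h (4*j+2) (by omega)
    rw [cross_poly] at this
    simp only [add_assoc (4*j), pw] at this
    simpa only [Nat.reduceAdd, s2, s3, s4, s5, zero_mul, add_zero, zero_add] using this
  have d0 : d = 0 := by
    refine orth_zero n 4 d hd fun j hj => fin _ _ _ ?_
    have := h (4*j+1) (by omega)
    rw [cross_poly] at this
    simp only [add_assoc (4*j), pw] at this
    simpa only [Nat.reduceAdd, s1, s2, s3, s4, zero_mul, add_zero, zero_add] using this
  simp [a0, b0, c0, d0]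

/-- If `P` is the `n`-th monic polynomial orthogonal on `[0,1]` to `x^j`,
`j < n`, with weight `x^{-3/4}(1-x)^{-1/4}`, then `∫_Δ s^k P(s⁴) ρ(s) ds = 0` for all
`k ∈ {0,…,4n-1}`, hence `Q_{4n}(z) = P(z⁴)`. -/
theorem stmt7 (n : ℕ) (P : ℂ[X]) (hP : P.Monic) (hPdeg : P.natDegree = n)
    (hPortho : ∀ j < n, (∫ x in (0:ℝ)..1, (x : ℂ) ^ j * P.eval (x : ℂ) *
      (((x ^ (-(3:ℝ)/4) * (1 - x) ^ (-(1:ℝ)/4) : ℝ)) : ℂ)) = 0) :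
    (∀ k < 4 * n, crossIntJac (fun s => s ^ k * P.eval (s ^ 4)) = 0) ∧
    ∀ Q : ℂ[X], Q.Monic → OrthoJac (4 * n) Q →
      (∀ R : ℂ[X], R.Monic → OrthoJac (4 * n) R → Q.natDegree ≤ R.natDegree) →
      Q = P.comp (X ^ 4) := by

  have hE : P.comp (X ^ 4) = expand ℂ 4 P := (expand_eq_comp_X_pow 4).symm
  have part1 : ∀ k < 4 * n, crossIntJac (fun s => s ^ k * P.eval (s ^ 4)) = 0 := by
    intro k hk
    have hc := cross_poly P 0 0 0 k
    simp only [map_zero, mul_zero, add_zero, expand_eval, eval_zero] at hc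
    rw [hc]
    obtain ⟨j, s, hs, rfl⟩ : ∃ j s, s < 4 ∧ k = 4 * j + s :=
      ⟨k / 4, k % 4, Nat.mod_lt _ (by norm_num), (Nat.div_add_mod k 4).symm⟩
    simp only [pw]
    interval_cases s
    · have h := hPortho j (by omega)
      rw [← subst_eq (fun x : ℝ => (x : ℂ) ^ j * P.eval (x : ℂ))] at h
      simp only [s0, add_zero, pow_mul]
      simp only [ofReal_pow, ← mul_assoc] at h
      rw [h, mul_zero]
    · simp only [s1, zero_mul, intervalIntegral.integral_zero, mul_zero]
    · simp only [s2, zero_mul, intervalIntegral.integral_zero, mul_zero]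
    · simp only [s3, zero_mul, intervalIntegral.integral_zero, mul_zero]
  refine ⟨part1, ?_⟩
  intro Q hQ hQo hmin
  rw [hE]
  have hEm : (expand ℂ 4 P).Monic := hP.expand (by norm_num)
  have hEo : OrthoJac (4 * n) (expand ℂ 4 P) := by
    intro k hk
    simpa only [expand_eval] using part1 k hk
  have hEd : (expand ℂ 4 P).natDegree = 4 * n := by
    rw [natDegree_expand, hPdeg, mul_comm]
  have hle := hmin _ hEm hEo
  rw [hEd] at hle
  rcases hle.lt_or_eq with hlt | heq
  · exact absurd (ortho_zero n Q ((natDegree_lt_iff_degree_lt hQ.ne_zero).1 hlt) hQo) hQ.ne_zero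
  · have hdQ : Q.degree = (4 * n : ℕ) := by rw [degree_eq_natDegree hQ.ne_zero, heq]
    have hdE : (expand ℂ 4 P).degree = (4 * n : ℕ) := by
      rw [degree_eq_natDegree hEm.ne_zero, hEd]
    have hlt : (Q - expand ℂ 4 P).degree < (4 * n : ℕ) := by
      rw [← hdQ]
      exact degree_sub_lt (hdQ.trans hdE.symm) hQ.ne_zero (by rw [hQ.leadingCoeff, hEm.leadingCoeff])
    refine sub_eq_zero.1 (ortho_zero n _ hlt ?_)
    intro k hk
    have := cross_sub (fun s => s ^ k * Q.eval s) (fun s => s ^ k * (expand ℂ 4 P).eval s)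
      (by fun_prop) (by fun_prop)
    rw [hQo k hk, hEo k hk, sub_zero] at this
    simpa only [eval_sub, mul_sub] using this
end

section
/- Let P_{n,2} be the n-th monic polynomial orthogonal on [0,1] to x^j, j = 0,...,n-1, with respect to the weight x^{1/4}(1-x)^{-1/4}. In the setting of the Jacobi-1/4 weight on the cross Δ = [-1,1] ∪ [-i,i] (ρ(s) = -i^{4-j}/|sqrt(w)(s)| on Δ_j), the polynomial z ↦ z P_{n,2}(z^4) of degree 4n+1 satisfies ∫_Δ s^k z P_{n,2}(s^4) ρ(s) ds = 0 for all k ∈ {0, ..., 4n + 2}, hence Q_{4n+1} = Q_{4n+2} = Q_{4n+3} = z P_{n,2}(z^4). -/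
open Complex Polynomial intervalIntegral

/-- The orthogonality integral `∫_Δ f(s) ρ(s) ds` over the cross `Δ = [-1,1] ∪ [-i,i]`
(arms oriented towards the origin) for the Jacobi-1/4 weight `ρ(s) = -i^{4-j}/|√w(s)|` on
`Δ_j` (see the paper's Section 3.3). -/
noncomputable def crossIntJac' (f : ℂ → ℂ) : ℂ :=
    -(∫ x in (0:ℝ)..1, f (x : ℂ) * (I / (((1 - x ^ 4) ^ ((1:ℝ)/4) : ℝ) : ℂ)))
    + (∫ x in (-1:ℝ)..0, f (x : ℂ) * (-I / (((1 - x ^ 4) ^ ((1:ℝ)/4) : ℝ) : ℂ)))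
    + (-I * ∫ y in (0:ℝ)..1, f (I * (y : ℂ)) * (1 / (((1 - y ^ 4) ^ ((1:ℝ)/4) : ℝ) : ℂ)))
    + (I * ∫ y in (-1:ℝ)..0, f (I * (y : ℂ)) * (-1 / (((1 - y ^ 4) ^ ((1:ℝ)/4) : ℝ) : ℂ)))

/-- `Q` satisfies the orthogonality relations `∫_Δ s^k Q(s) ρ(s) ds = 0`, `k < m`. -/
def OrthoJac' (m : ℕ) (Q : ℂ[X]) : Prop :=
  ∀ k < m, crossIntJac' (fun s => s ^ k * Q.eval s) = 0


noncomputable def ww (x : ℝ) : ℝ := ((1 - x ^ 4) ^ ((1:ℝ)/4))⁻¹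

lemma ww_int : IntervalIntegrable ww MeasureTheory.volume 0 1 := by
  have h1 : IntervalIntegrable (fun x : ℝ => (1 - x) ^ (-(1:ℝ)/4)) MeasureTheory.volume 0 1 := by
    have h := (intervalIntegral.intervalIntegrable_rpow' (a := 0) (b := 1) (r := -(1:ℝ)/4) (by norm_num)).comp_sub_left 1
    simpa using h.symm
  refine h1.mono_fun ?_ ?_
  · unfold ww
    exact (by fun_prop : Measurable (fun x : ℝ => ((1 - x ^ 4) ^ ((1:ℝ)/4))⁻¹)).aestronglyMeasurable
  · refine (MeasureTheory.ae_restrict_iff' measurableSet_uIoc).2 (Filter.Eventually.of_forall fun x hx => ?_)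
    rw [Set.uIoc_of_le zero_le_one] at hx
    obtain ⟨h0, h1⟩ := hx
    have hx4 : x ^ 4 ≤ x := by
      have := pow_le_pow_of_le_one h0.le h1 (show 1 ≤ 4 by norm_num)
      simpa using this
    simp only [ww]
    rw [← Real.rpow_neg (by linarith)]
    rw [Real.norm_of_nonneg (Real.rpow_nonneg (by linarith) _), Real.norm_of_nonneg (Real.rpow_nonneg (by linarith) _)]
    rcases h1.eq_or_lt with rfl | h1
    · norm_num
    · rw [show -((1:ℝ)/4) = -(1:ℝ)/4 by ring]
      exact Real.rpow_le_rpow_of_nonpos (by linarith) (by linarith) (by norm_num)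

lemma cww_int (f : ℝ → ℂ) (hf : Continuous f) :
    IntervalIntegrable (fun x => f x * (ww x : ℂ)) MeasureTheory.volume 0 1 := by
  have h : IntervalIntegrable (fun x => (ww x : ℂ)) MeasureTheory.volume 0 1 := by
    have := ww_int
    rw [intervalIntegrable_iff] at this ⊢
    exact this.ofReal
  exact h.continuousOn_mul hf.continuousOn

lemma L_formula (f : ℂ → ℂ) (hf : Continuous f) :
    crossIntJac' f = -I * ∫ x in (0:ℝ)..1,
      (f x + f (-x) + f (I * x) + f (-(I * x))) * (ww x : ℂ) := by
  have e2 : (∫ x in (-1:ℝ)..0, f (x : ℂ) * (-I / (((1 - x ^ 4) ^ ((1:ℝ)/4) : ℝ) : ℂ)))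
      = -I * ∫ x in (0:ℝ)..1, f (-x) * (ww x : ℂ) := by
    rw [← intervalIntegral.integral_const_mul]
    have := intervalIntegral.integral_comp_neg (a := 0) (b := 1) (fun x : ℝ => f (x : ℂ) * (-I / (((1 - x ^ 4) ^ ((1:ℝ)/4) : ℝ) : ℂ)))
    rw [neg_zero] at this
    rw [← this]
    congr 1; ext x
    simp only [ww, ofReal_neg, ofReal_inv, Even.neg_pow (show Even 4 by decide)]
    ring
  have e4 : (∫ y in (-1:ℝ)..0, f (I * (y : ℂ)) * (-1 / (((1 - y ^ 4) ^ ((1:ℝ)/4) : ℝ) : ℂ)))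
      = - ∫ x in (0:ℝ)..1, f (-(I*x)) * (ww x : ℂ) := by
    rw [← intervalIntegral.integral_neg]
    have := intervalIntegral.integral_comp_neg (a := 0) (b := 1) (fun y : ℝ => f (I * (y : ℂ)) * (-1 / (((1 - y ^ 4) ^ ((1:ℝ)/4) : ℝ) : ℂ)))
    rw [neg_zero] at this
    rw [← this]
    congr 1; ext x
    simp only [ww, ofReal_neg, ofReal_inv, Even.neg_pow (show Even 4 by decide), mul_neg]
    ring
  have e1 : (∫ x in (0:ℝ)..1, f (x : ℂ) * (I / (((1 - x ^ 4) ^ ((1:ℝ)/4) : ℝ) : ℂ)))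
      = I * ∫ x in (0:ℝ)..1, f x * (ww x : ℂ) := by
    rw [← intervalIntegral.integral_const_mul]
    congr 1; ext x
    simp only [ww, ofReal_inv]
    ring
  have e3 : (∫ y in (0:ℝ)..1, f (I * (y : ℂ)) * (1 / (((1 - y ^ 4) ^ ((1:ℝ)/4) : ℝ) : ℂ)))
      = ∫ x in (0:ℝ)..1, f (I * x) * (ww x : ℂ) := by
    congr 1; ext x
    simp only [ww, ofReal_inv]
    ring
  unfold crossIntJac'
  rw [e1, e2, e3, e4]
  have i1 := cww_int (fun x => f x) (by fun_prop)
  have i2 := cww_int (fun x => f (-x)) (by fun_prop)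
  have i3 := cww_int (fun x => f (I * x)) (by fun_prop)
  have i4 := cww_int (fun x => f (-(I * x))) (by fun_prop)
  simp only [add_mul]
  rw [intervalIntegral.integral_add ((i1.add i2).add i3) i4, intervalIntegral.integral_add (i1.add i2) i3,
    intervalIntegral.integral_add i1 i2]
  ring

lemma pos_lemma (q : ℂ[X]) (a N : ℕ) (hN : q.natDegree ≤ N)
    (h : ∀ l ≤ N, ∫ x in (0:ℝ)..1, ((x:ℂ) ^ (a + 4 * l) * q.eval ((x:ℂ) ^ 4)) * (ww x : ℂ) = 0) :
    q = 0 := by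
  by_contra hq
  have key : ∫ x in (0:ℝ)..1, (x ^ a * normSq (q.eval ((x:ℂ)^4))) * ww x = 0 := by
    rw [← Complex.ofReal_inj, ← intervalIntegral.integral_ofReal]
    have : ∀ x : ℝ, (((x ^ a * normSq (q.eval ((x:ℂ)^4))) * ww x : ℝ) : ℂ)
        = ∑ l ∈ Finset.range (N+1), (starRingEnd ℂ) (q.coeff l) *
          (((x:ℂ) ^ (a + 4 * l) * q.eval ((x:ℂ) ^ 4)) * (ww x : ℂ)) := by
      intro x
      have h1 : (starRingEnd ℂ) (q.eval ((x:ℂ)^4)) = ∑ l ∈ Finset.range (N+1), (starRingEnd ℂ) (q.coeff l) * (x:ℂ)^(4*l) := by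
        rw [Polynomial.eval_eq_sum_range' (Nat.lt_succ_of_le hN), map_sum]
        refine Finset.sum_congr rfl fun l _ => ?_
        simp [pow_mul]
      push_cast
      rw [Complex.normSq_eq_conj_mul_self, h1, Finset.sum_mul, Finset.mul_sum, Finset.sum_mul]
      refine Finset.sum_congr rfl fun l _ => ?_
      ring
    simp only [this]
    rw [intervalIntegral.integral_finset_sum]
    · simp only [intervalIntegral.integral_const_mul]
      rw [Finset.sum_eq_zero]
      · simp
      · intro l hl
        rw [h l (by simpa [Nat.lt_succ_iff] using hl), mul_zero]
    · intro l _
      exact (cww_int (fun x => (x:ℂ) ^ (a + 4 * l) * q.eval ((x:ℂ) ^ 4)) (by fun_prop)).const_mul _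
  have hint : IntervalIntegrable (fun x : ℝ => (x ^ a * normSq (q.eval ((x:ℂ)^4))) * ww x) MeasureTheory.volume 0 1 := by
    refine ww_int.continuousOn_mul (Continuous.continuousOn ?_)
    have := Complex.continuous_normSq
    fun_prop
  have hwpos : ∀ x : ℝ, 0 < x → x < 1 → 0 < ww x := by
    intro x h0 h1
    have : x ^ 4 < 1 := pow_lt_one₀ h0.le h1 (by norm_num)
    exact inv_pos.2 (Real.rpow_pos_of_pos (by linarith) _)
  have hnn : 0 ≤ᵐ[MeasureTheory.volume.restrict (Set.Ioc (0:ℝ) 1)] (fun x : ℝ => (x ^ a * normSq (q.eval ((x:ℂ)^4))) * ww x) := by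
    refine (MeasureTheory.ae_restrict_iff' measurableSet_Ioc).2 (Filter.Eventually.of_forall fun x hx => ?_)
    have h4 : x ^ 4 ≤ 1 := pow_le_one₀ hx.1.le hx.2
    have : 0 ≤ ww x := inv_nonneg.2 (Real.rpow_nonneg (by linarith) _)
    have := normSq_nonneg (q.eval ((x:ℂ)^4))
    have := pow_nonneg hx.1.le a
    simp only [Pi.zero_apply]
    positivity
  rw [intervalIntegral.integral_eq_zero_iff_of_le_of_nonneg_ae zero_le_one hnn hint] at key
  have key2 := (MeasureTheory.ae_restrict_iff' measurableSet_Ioc).1 key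
  have hfin : {x : ℝ | 0 < x ∧ q.eval ((x:ℂ)^4) = 0}.Finite := by
    refine Set.Finite.of_finite_image (f := fun x : ℝ => (x:ℂ)^4) ((q.roots.toFinset.finite_toSet).subset ?_) ?_
    · rintro _ ⟨x, ⟨_, hx⟩, rfl⟩
      simp [hq, hx]
    · rintro x ⟨hx, _⟩ y ⟨hy, _⟩ hxy
      have hxy : x ^ 4 = y ^ 4 := by
        simp only at hxy
        exact_mod_cast hxy
      exact (pow_left_inj₀ hx.le hy.le (by norm_num)).1 hxy
  have hfin' := (hfin.union (Set.finite_singleton 1)).countable.ae_notMem MeasureTheory.volume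
  have hae : ∀ᵐ x : ℝ, x ∉ Set.Ioc (0:ℝ) 1 := by
    filter_upwards [key2, hfin'] with x h1 h2 h3
    have h4 := h1 h3
    simp only [Set.mem_union, Set.mem_setOf_eq, Set.mem_singleton_iff, not_or, not_and] at h2
    have h5 := hwpos x h3.1 (lt_of_le_of_ne h3.2 h2.2)
    have h6 := normSq_pos.2 (h2.1 h3.1)
    have h7 := pow_pos h3.1 a
    have h8 := mul_pos (mul_pos h7 h6) h5
    simp only [Pi.zero_apply] at h4
    linarith
  have := MeasureTheory.measure_eq_zero_iff_ae_notMem.2 hae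
  simp at this

lemma subst_lemma (P : ℂ[X]) (l : ℕ) :
    4 * (∫ x in (0:ℝ)..1, ((x:ℂ) ^ (4 * l + 4) * P.eval ((x:ℂ) ^ 4)) * (ww x : ℂ)) =
    ∫ x in (0:ℝ)..1, (x : ℂ) ^ l * P.eval (x : ℂ) *
      (((x ^ ((1:ℝ)/4) * (1 - x) ^ (-(1:ℝ)/4) : ℝ)) : ℂ) := by
  rw [← intervalIntegral.integral_const_mul, intervalIntegral.integral_of_le zero_le_one, intervalIntegral.integral_of_le zero_le_one,
    MeasureTheory.integral_Ioc_eq_integral_Ioo, MeasureTheory.integral_Ioc_eq_integral_Ioo]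
  have himg : (fun x : ℝ => x ^ 4) '' Set.Ioo 0 1 = Set.Ioo 0 1 := by
    ext y
    constructor
    · rintro ⟨x, hx, rfl⟩
      exact ⟨pow_pos hx.1 4, pow_lt_one₀ hx.1.le hx.2 (by norm_num)⟩
    · intro hy
      refine ⟨y ^ ((1:ℝ)/4), ⟨Real.rpow_pos_of_pos hy.1 _, Real.rpow_lt_one hy.1.le hy.2 (by norm_num)⟩, ?_⟩
      simp only
      rw [← Real.rpow_natCast, ← Real.rpow_mul hy.1.le]
      norm_num
  have hinj : Set.InjOn (fun x : ℝ => x ^ 4) (Set.Ioo 0 1) := fun x hx y hy hxy =>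
    (pow_left_inj₀ hx.1.le hy.1.le (by norm_num)).1 hxy
  have := MeasureTheory.integral_image_eq_integral_abs_deriv_smul (s := Set.Ioo (0:ℝ) 1) (f := fun x : ℝ => x ^ 4)
    (f' := fun x => 4 * x ^ 3) measurableSet_Ioo (fun x _ => by simpa using (hasDerivAt_pow 4 x).hasDerivWithinAt) hinj
    (fun x : ℝ => (x : ℂ) ^ l * P.eval (x : ℂ) *
      (((x ^ ((1:ℝ)/4) * (1 - x) ^ (-(1:ℝ)/4) : ℝ)) : ℂ))
  rw [himg] at this
  rw [this]
  refine MeasureTheory.setIntegral_congr_fun measurableSet_Ioo fun x hx => ?_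
  have h3 : 0 ≤ 4 * x ^ 3 := by have := pow_pos hx.1 3; linarith
  have h4 : x ^ 4 < 1 := pow_lt_one₀ hx.1.le hx.2 (by norm_num)
  have h5 : (x ^ 4) ^ ((1:ℝ)/4) = x := by
    rw [← Real.rpow_natCast, ← Real.rpow_mul hx.1.le]
    norm_num
  simp only [abs_of_nonneg h3, h5, Complex.real_smul, ww]
  rw [show -(1:ℝ)/4 = -((1:ℝ)/4) by ring, Real.rpow_neg (by linarith)]
  push_cast
  ring

lemma I_sum (j : ℕ) : (1 + (-1)^j + I^j + (-I)^j : ℂ) = if 4 ∣ j then 4 else 0 := by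
  have h : j = 4 * (j / 4) + j % 4 := by omega
  have hl : j % 4 < 4 := Nat.mod_lt _ (by norm_num)
  have hI : (-I)^4 = 1 := by rw [Even.neg_pow (by decide), I_pow_four]
  have hm1 : (-1:ℂ)^4 = 1 := by norm_num
  by_cases hd : 4 ∣ j
  · obtain ⟨a, rfl⟩ := hd
    simp only [pow_mul, I_pow_four, hI]
    norm_num
  · rw [if_neg hd, h]
    simp only [pow_add, pow_mul, I_pow_four, hI, hm1, one_pow, one_mul]
    have h0 : j % 4 ≠ 0 := by omega
    interval_cases (j % 4)
    · simp at h0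
    · simp
    · simp
    · simp [pow_succ]

/-- components -/
noncomputable def comp4 (Q : ℂ[X]) (r : ℕ) : ℂ[X] := contract 4 (divX^[r] Q)

lemma comp4_coeff (Q : ℂ[X]) (r l : ℕ) : (comp4 Q r).coeff l = Q.coeff (4 * l + r) := by
  have : ∀ r (Q : ℂ[X]) m, (divX^[r] Q).coeff m = Q.coeff (m + r) := by
    intro r
    induction r with
    | zero => simp
    | succ r ih => intro Q m; rw [Function.iterate_succ_apply, ih, coeff_divX, add_assoc]
  rw [comp4, coeff_contract (by norm_num), this, mul_comm]

lemma comp4_sum (Q : ℂ[X]) : Q = ∑ r ∈ Finset.range 4, X ^ r * expand ℂ 4 (comp4 Q r) := by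
  ext j
  obtain ⟨a, b, hb, rfl⟩ : ∃ a b, b < 4 ∧ j = 4 * a + b := ⟨j/4, j%4, Nat.mod_lt _ (by norm_num), by omega⟩
  rw [finset_sum_coeff, Finset.sum_eq_single b]
  · rw [coeff_X_pow_mul', if_pos (by omega), coeff_expand (by norm_num), if_pos (by omega), comp4_coeff]
    congr 1; omega
  · intro r hr hrb
    rw [Finset.mem_range] at hr
    rw [coeff_X_pow_mul']
    split_ifs with h
    · rw [coeff_expand (by norm_num), if_neg (by omega)]
    · rfl
  · intro h; simp at h; omega

lemma L_comp (Q : ℂ[X]) (k r : ℕ) (hr : r < 4) (hk : 4 ∣ k + r) :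
    crossIntJac' (fun s => s ^ k * Q.eval s) =
     -I * (4 * ∫ x in (0:ℝ)..1, ((x:ℂ) ^ (k + r) * (comp4 Q r).eval ((x:ℂ) ^ 4)) * (ww x : ℂ)) := by
  rw [L_formula _ (by fun_prop), ← intervalIntegral.integral_const_mul (4:ℂ)]
  congr 2; ext x
  have hev : ∀ s : ℂ, s ^ k * Q.eval s = ∑ r ∈ Finset.range 4, s ^ (k + r) * (comp4 Q r).eval (s^4) := by
    intro s
    conv_lhs => rw [comp4_sum Q]
    rw [eval_finset_sum, Finset.mul_sum]
    refine Finset.sum_congr rfl fun i _ => ?_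
    simp [expand_eval]; ring
  have h4 : (I * (x:ℂ))^4 = x^4 := by rw [mul_pow, I_pow_four, one_mul]
  simp only [hev, Even.neg_pow (show Even 4 by decide), h4]
  rw [← Finset.sum_add_distrib, ← Finset.sum_add_distrib, ← Finset.sum_add_distrib]
  have : ∀ i ∈ Finset.range 4, (x:ℂ) ^ (k + i) * (comp4 Q i).eval ((x:ℂ)^4) + (-(x:ℂ)) ^ (k + i) * (comp4 Q i).eval ((x:ℂ)^4)
      + (I * (x:ℂ)) ^ (k + i) * (comp4 Q i).eval ((x:ℂ)^4) + (-(I * (x:ℂ))) ^ (k + i) * (comp4 Q i).eval ((x:ℂ)^4)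
      = if i = r then 4 * ((x:ℂ) ^ (k + i) * (comp4 Q i).eval ((x:ℂ)^4)) else 0 := by
    intro i hi
    rw [Finset.mem_range] at hi
    have e1 : (-(x:ℂ)) ^ (k+i) = (-1)^(k+i) * (x:ℂ)^(k+i) := by rw [← mul_pow]; ring
    have e2 : (-(I * (x:ℂ))) ^ (k+i) = (-I)^(k+i) * (x:ℂ)^(k+i) := by rw [← mul_pow]; ring
    rw [e1, e2, mul_pow]
    have := I_sum (k+i)
    split_ifs with hir
    · rw [if_pos (by omega)] at this
      linear_combination ((x:ℂ)^(k+i) * (comp4 Q i).eval ((x:ℂ)^4)) * this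
    · rw [if_neg (by omega)] at this
      linear_combination ((x:ℂ)^(k+i) * (comp4 Q i).eval ((x:ℂ)^4)) * this
  rw [Finset.sum_congr rfl this, Finset.sum_ite_eq' , if_pos (Finset.mem_range.2 hr)]
  ring

lemma comp4_M (P : ℂ[X]) (r : ℕ) (hr : r < 4) : comp4 (X * P.comp (X^4)) r = if r = 1 then P else 0 := by
  ext l
  rw [comp4_coeff, ← expand_eq_comp_X_pow]
  obtain _ | r := r
  · obtain _ | l := l
    · simp
    · rw [show 4 * (l+1) + 0 = (4 * l + 3) + 1 by ring, coeff_X_mul, coeff_expand (by norm_num), if_neg (by omega)]; simp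
  · rw [← add_assoc, coeff_X_mul, coeff_expand (by norm_num)]
    by_cases h : r = 0
    · subst h; simp
    · rw [if_neg (by omega), if_neg (by omega)]; simp

lemma L_sub (Q M : ℂ[X]) (c : ℂ) (k : ℕ) (h1 : crossIntJac' (fun s => s ^ k * Q.eval s) = 0)
    (h2 : crossIntJac' (fun s => s ^ k * M.eval s) = 0) :
    crossIntJac' (fun s => s ^ k * (Q - C c * M).eval s) = 0 := by
  rw [L_formula _ (by fun_prop)] at h1 h2 ⊢
  have i1 := cww_int (fun x => ((x:ℂ) ^ k * Q.eval (x:ℂ)) + ((-(x:ℂ)) ^ k * Q.eval (-(x:ℂ))) + ((I * (x:ℂ)) ^ k * Q.eval (I * (x:ℂ))) + ((-(I * (x:ℂ))) ^ k * Q.eval (-(I * (x:ℂ))))) (by fun_prop)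
  have i2 := cww_int (fun x => ((x:ℂ) ^ k * M.eval (x:ℂ)) + ((-(x:ℂ)) ^ k * M.eval (-(x:ℂ))) + ((I * (x:ℂ)) ^ k * M.eval (I * (x:ℂ))) + ((-(I * (x:ℂ))) ^ k * M.eval (-(I * (x:ℂ))))) (by fun_prop)
  have h3 := intervalIntegral.integral_sub i1 (i2.const_mul c)
  rw [intervalIntegral.integral_const_mul] at h3
  have h4 : -I * (∫ x in (0:ℝ)..1, _) = -I * (_ - c * _) := congrArg (fun t => -I * t) h3
  rw [mul_sub, h1, mul_left_comm, h2, mul_zero, sub_zero] at h4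
  rw [← h4]
  congr 2; ext x
  simp only [eval_sub, eval_mul, eval_C]
  ring

/-- If `P` is the `n`-th monic polynomial orthogonal on `[0,1]` to `x^j`,
`j < n`, with weight `x^{1/4}(1-x)^{-1/4}`, then the degree-`4n+1` polynomial `z P(z⁴)`
satisfies `∫_Δ s^k s P(s⁴) ρ(s) ds = 0` for all `k ∈ {0,…,4n+2}`, hence
`Q_{4n+1} = Q_{4n+2} = Q_{4n+3} = z P(z⁴)`. -/
theorem stmt8 (n : ℕ) (P : ℂ[X]) (hP : P.Monic) (hPdeg : P.natDegree = n)
    (hPortho : ∀ j < n, (∫ x in (0:ℝ)..1, (x : ℂ) ^ j * P.eval (x : ℂ) *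
      (((x ^ ((1:ℝ)/4) * (1 - x) ^ (-(1:ℝ)/4) : ℝ)) : ℂ)) = 0) :
    (∀ k ≤ 4 * n + 2, crossIntJac' (fun s => s ^ k * (s * P.eval (s ^ 4))) = 0) ∧
    ∀ m ∈ ({4 * n + 1, 4 * n + 2, 4 * n + 3} : Set ℕ), ∀ Q : ℂ[X], Q.Monic → OrthoJac' m Q →
      (∀ R : ℂ[X], R.Monic → OrthoJac' m R → Q.natDegree ≤ R.natDegree) →
      Q = X * P.comp (X ^ 4) := by
  have hA : ∀ k ≤ 4 * n + 2, crossIntJac' (fun s => s ^ k * (X * P.comp (X ^ 4)).eval s) = 0 := by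
    intro k hk
    obtain ⟨r, hr, hd⟩ : ∃ r < 4, 4 ∣ k + r := ⟨(4 - k % 4) % 4, Nat.mod_lt _ (by norm_num), by omega⟩
    rw [L_comp _ k r hr hd, comp4_M P r hr]
    split_ifs with h1
    · subst h1
      obtain ⟨l, rfl⟩ : ∃ l, k = 4 * l + 3 := ⟨k / 4, by omega⟩
      have := subst_lemma P l
      rw [hPortho l (by omega)] at this
      rw [show 4 * l + 3 + 1 = 4 * l + 4 by ring, this, mul_zero]
    · simp
  refine ⟨fun k hk => by simpa using hA k hk, ?_⟩
  intro m hm Q hQ hQo hmin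
  have hm' : 4 * n + 1 ≤ m ∧ m ≤ 4 * n + 3 := by
    simp only [Set.mem_insert_iff, Set.mem_singleton_iff] at hm; omega
  set M : ℂ[X] := X * P.comp (X ^ 4) with hM
  have hPc : (P.comp (X^4)).Monic := by
    rw [← expand_eq_comp_X_pow]; exact hP.expand (by norm_num)
  have hMm : M.Monic := monic_X.mul hPc
  have hMd : M.natDegree = 4 * n + 1 := by
    rw [hM, monic_X.natDegree_mul hPc, natDegree_X, natDegree_comp, natDegree_X_pow, hPdeg]; ring
  have hQd : Q.natDegree ≤ 4 * n + 1 := hMd ▸ hmin M hMm (fun k hk => hA k (by omega))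
  set c := Q.coeff (4 * n + 1) with hc
  set D := Q - C c * M with hD
  have hDo : ∀ k < 4 * n + 1, crossIntJac' (fun s => s ^ k * D.eval s) = 0 := fun k hk =>
    L_sub Q M c k (hQo k (by omega)) (hA k (by omega))
  have hDc : ∀ i, 4 * n + 1 ≤ i → D.coeff i = 0 := by
    intro i hi
    rw [hD, coeff_sub, coeff_C_mul]
    rcases hi.eq_or_lt with rfl | hi
    · have : M.coeff (4 * n + 1) = 1 := by rw [← hMd]; exact hMm
      rw [this, hc]; ring
    · rw [coeff_eq_zero_of_natDegree_lt (by omega), coeff_eq_zero_of_natDegree_lt (by omega)]; ring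
  have hcomp : ∀ r < 4, comp4 D r = 0 := by
    intro r hr
    by_contra hne
    set N := (comp4 D r).natDegree with hN
    have hlt : 4 * N + r < 4 * n + 1 := by
      by_contra hge
      have := hDc (4 * N + r) (by omega)
      rw [← comp4_coeff] at this
      exact hne (leadingCoeff_eq_zero.1 this)
    apply hne
    refine pos_lemma _ ((4 - r) % 4 + r) N le_rfl fun l hl => ?_
    have h1 := hDo ((4 - r) % 4 + 4 * l) (by omega)
    rw [L_comp D _ r hr (by omega)] at h1
    rw [show (4 - r) % 4 + r + 4 * l = (4 - r) % 4 + 4 * l + r by ring]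
    simpa using h1
  have hD0 : D = 0 := by
    rw [comp4_sum D]
    refine Finset.sum_eq_zero fun r hr => ?_
    rw [hcomp r (Finset.mem_range.1 hr)]; simp
  have hQM : Q = C c * M := sub_eq_zero.1 hD0
  have hc1 : c = 1 := by
    have := congrArg leadingCoeff hQM
    rw [leadingCoeff_mul, leadingCoeff_C, hMm.leadingCoeff, hQ.leadingCoeff, mul_one] at this
    exact this.symm
  rw [hQM, hc1]; simp
end
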